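/- arXiv:1307.3916 — 5 statements merged into one kernel-verified Lean document; each statement's English description precedes it below -/
import Mathlib

section
/- Let $\{a_n\}_{n\ge 1}$ be a decreasing sequence of positive real numbers and let $\alpha, \beta$ be positive real constants. If the series $\sum_{n=1}^{\infty} n^{\alpha} a_n^{\beta}$ converges, then $a_n = o(n^{-(\alpha+1)/\beta})$ as $n \to \infty$, i.e. $n^{(\alpha+1)/\beta} a_n \to 0$. -/
/-- If `{a n}` is a decreasing sequence of positive reals and
`∑ n^α * (a n)^β` converges for some positive reals `α, β`, then
`a n = o(n^(-(α+1)/β))`, i.e. `n^((α+1)/β) * a n → 0`. -/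
theorem stmt_0 (a : ℕ → ℝ) (α β : ℝ) (hα : 0 < α) (hβ : 0 < β)
    (hpos : ∀ n, 1 ≤ n → 0 < a n)
    (hdec : ∀ n, 1 ≤ n → a (n + 1) ≤ a n)
    (hsum : Summable (fun n : ℕ => (n : ℝ) ^ α * (a n) ^ β)) :
    Filter.Tendsto (fun n : ℕ => (n : ℝ) ^ ((α + 1) / β) * a n)
      Filter.atTop (nhds 0) := by
  have hmono : ∀ k n, 1 ≤ k → k ≤ n → a n ≤ a k := by
    intro k n hk hkn
    induction n, hkn using Nat.le_induction with
    | base => exact le_rfl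
    | succ n hn ih => exact (hdec n (hk.trans hn)).trans ih
  set f : ℕ → ℝ := fun n : ℕ => (n : ℝ) ^ α * (a n) ^ β with hf
  set T : ℕ → ℝ := fun m => ∑ k ∈ Finset.range m, f k with hT
  have hTt : Filter.Tendsto T Filter.atTop (nhds (∑' k, f k)) := hsum.hasSum.tendsto_sum_nat
  have h1 : Filter.Tendsto (fun n : ℕ => n + 1) Filter.atTop Filter.atTop :=
    Filter.tendsto_add_atTop_nat 1
  have h2 : Filter.Tendsto (fun n : ℕ => n / 2 + 1) Filter.atTop Filter.atTop :=
    h1.comp (Nat.tendsto_div_const_atTop (by norm_num))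
  have hD : Filter.Tendsto (fun n : ℕ => (2:ℝ) ^ (α + 1) * (T (n + 1) - T (n / 2 + 1)))
      Filter.atTop (nhds 0) := by
    have := ((hTt.comp h1).sub (hTt.comp h2)).const_mul ((2:ℝ) ^ (α + 1))
    simpa using this
  have hkey : ∀ n : ℕ, 1 ≤ n →
      (n : ℝ) ^ (α + 1) * (a n) ^ β ≤ (2:ℝ) ^ (α + 1) * (T (n + 1) - T (n / 2 + 1)) := by
    intro n hn
    have hn0 : (0:ℝ) < n := by exact_mod_cast hn
    have e : T (n + 1) - T (n / 2 + 1) = ∑ k ∈ Finset.Ico (n / 2 + 1) (n + 1), f k :=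
      (Finset.sum_Ico_eq_sub f (by omega)).symm
    have hb : ∀ k ∈ Finset.Ico (n / 2 + 1) (n + 1), ((n : ℝ) / 2) ^ α * (a n) ^ β ≤ f k := by
      intro k hk
      rw [Finset.mem_Ico] at hk
      have hk2 : (n : ℝ) / 2 ≤ k := by
        have : n ≤ 2 * k := by omega
        have : (n : ℝ) ≤ 2 * k := by exact_mod_cast this
        linarith
      have := hpos n hn
      exact mul_le_mul (Real.rpow_le_rpow (by positivity) hk2 hα.le)
        (Real.rpow_le_rpow this.le (hmono k n (by omega) (by omega)) hβ.le)
        (by positivity) (by positivity)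
    have hs := Finset.card_nsmul_le_sum _ _ _ hb
    rw [Nat.card_Ico, nsmul_eq_mul, ← e] at hs
    have hc : (n : ℝ) / 2 ≤ ((n + 1 - (n / 2 + 1) : ℕ) : ℝ) := by
      have : n ≤ 2 * (n + 1 - (n / 2 + 1)) := by omega
      have : (n : ℝ) ≤ 2 * ((n + 1 - (n / 2 + 1) : ℕ) : ℝ) := by exact_mod_cast this
      linarith
    have hp := hpos n hn
    have h3 : (n : ℝ) / 2 * (((n : ℝ) / 2) ^ α * (a n) ^ β) ≤ T (n + 1) - T (n / 2 + 1) :=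
      (mul_le_mul_of_nonneg_right hc (by positivity)).trans hs
    have h4 : (n : ℝ) ^ (α + 1) = 2 ^ (α + 1) * ((n : ℝ) / 2 * ((n : ℝ) / 2) ^ α) := by
      have : (n : ℝ) / 2 * ((n : ℝ) / 2) ^ α = ((n : ℝ) / 2) ^ (α + 1) := by
        rw [Real.rpow_add_one (by positivity), mul_comm]
      rw [this, ← Real.mul_rpow (by norm_num) (by positivity)]
      congr 1
      ring
    rw [h4, mul_assoc, mul_assoc ((n : ℝ) / 2)]
    exact mul_le_mul_of_nonneg_left h3 (by positivity)
  have hg : Filter.Tendsto (fun n : ℕ => (n : ℝ) ^ (α + 1) * (a n) ^ β)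
      Filter.atTop (nhds 0) := by
    refine tendsto_of_tendsto_of_tendsto_of_le_of_le' tendsto_const_nhds hD ?_ ?_
    · filter_upwards [Filter.eventually_ge_atTop 1] with n hn
      have := hpos n hn
      positivity
    · filter_upwards [Filter.eventually_ge_atTop 1] with n hn using hkey n hn
  have hr := hg.rpow_const (p := 1 / β) (Or.inr (by positivity))
  rw [Real.zero_rpow (by positivity)] at hr
  refine hr.congr' ?_
  filter_upwards [Filter.eventually_ge_atTop 1] with n hn
  have hp := hpos n hn
  rw [Real.mul_rpow (by positivity) (by positivity), ← Real.rpow_mul (by positivity),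
    ← Real.rpow_mul hp.le, mul_one_div, mul_one_div, div_self hβ.ne', Real.rpow_one]
end

section
/- Let $m \ge 2$ and $r \ge 1$ be integers and let $p$ be a real number with $p \le 2r+1$. Let $\{a_n\}_{n\ge 1}$ be a decreasing sequence of nonnegative real numbers such that the series $\sum_{n=1}^{\infty} n^{2r+m-p}\, a_{n^m}$ converges. Then the series $\sum_{n=1}^{\infty} n^{(2r+1-p)/m}\, a_n$ converges. -/
theorem aux_count (n j : ℕ) (hn : 1 ≤ n) :
    (n + 1) ^ (j + 1) ≤ n ^ (j + 1) + 3 ^ (j + 1) * n ^ j := by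
  induction j with
  | zero => simp
  | succ j ih =>
    have h1 : 1 ≤ 3 ^ (j + 1) := Nat.one_le_pow _ _ (by norm_num)
    have h2 : n ^ (j + 1) ≤ 3 ^ (j + 1) * n ^ (j + 1) := Nat.le_mul_of_pos_left _ h1
    have h3 : 3 ^ (j + 1) * n ^ j * 1 ≤ 3 ^ (j + 1) * n ^ j * n := Nat.mul_le_mul_left _ hn
    calc (n + 1) ^ (j + 1 + 1) = (n + 1) ^ (j + 1) * (n + 1) := pow_succ _ _
      _ ≤ (n ^ (j + 1) + 3 ^ (j + 1) * n ^ j) * (n + 1) := Nat.mul_le_mul_right _ ih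
      _ = n ^ (j + 1 + 1) + n ^ (j + 1) + 3 ^ (j + 1) * n ^ j * n
            + 3 ^ (j + 1) * n ^ j * 1 := by ring
      _ ≤ n ^ (j + 1 + 1) + 3 ^ (j + 1) * n ^ (j + 1) + 3 ^ (j + 1) * n ^ j * n
            + 3 ^ (j + 1) * n ^ j * n := by omega
      _ = n ^ (j + 1 + 1) + 3 ^ (j + 1 + 1) * n ^ (j + 1) := by ring

/-- Let `m ≥ 2`, `r ≥ 1` be integers, `p ≤ 2r + 1` real, and `{a n}` a decreasing
sequence of nonnegative reals with `∑ n^(2r+m-p) * a (n^m) < ∞`.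
Then `∑ n^((2r+1-p)/m) * a n` converges. -/
theorem stmt_8 (m r : ℕ) (hm : 2 ≤ m) (hr : 1 ≤ r) (p : ℝ)
    (hp : p ≤ 2 * r + 1)
    (a : ℕ → ℝ)
    (hnonneg : ∀ n, 1 ≤ n → 0 ≤ a n)
    (hdec : ∀ n, 1 ≤ n → a (n + 1) ≤ a n)
    (hsum : Summable (fun n : ℕ => (n : ℝ) ^ ((2 * r + m : ℝ) - p) * a (n ^ m))) :
    Summable (fun n : ℕ => (n : ℝ) ^ (((2 * r + 1 : ℝ) - p) / m) * a n) := by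
  obtain ⟨j, rfl⟩ : ∃ j, m = j + 1 := ⟨m - 1, by omega⟩
  have hanti : ∀ x y, 1 ≤ x → x ≤ y → a y ≤ a x := by
    intro x y hx hxy
    induction y, hxy using Nat.le_induction with
    | base => exact le_rfl
    | succ y hy ih => exact (hdec y (hx.trans hy)).trans ih
  set s : ℝ := (2 * r + 1 : ℝ) - p with hs
  have hs0 : 0 ≤ s := by rw [hs]; linarith
  have hexp : (2 * r + ((j + 1 : ℕ) : ℝ) : ℝ) - p = s + j := by rw [hs]; push_cast; ring
  rw [hexp] at hsum
  set f : ℕ → ℝ := fun n : ℕ => (n : ℝ) ^ (s / ((j + 1 : ℕ) : ℝ)) * a n with hf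
  set g : ℕ → ℝ := fun n : ℕ => (n : ℝ) ^ (s + j) * a (n ^ (j + 1)) with hg
  have hf0 : ∀ n, 1 ≤ n → 0 ≤ f n := fun n hn =>
    mul_nonneg (Real.rpow_nonneg (Nat.cast_nonneg n) _) (hnonneg n hn)
  have hg0 : ∀ n, 1 ≤ n → 0 ≤ g n := fun n hn =>
    mul_nonneg (Real.rpow_nonneg (Nat.cast_nonneg n) _) (hnonneg _ (Nat.one_le_pow _ _ hn))
  set C : ℝ := 3 ^ (j + 1) * 2 ^ s with hC
  have hC0 : 0 ≤ C := by positivity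
  have hblock : ∀ n : ℕ, 1 ≤ n →
      ∑ k ∈ Finset.Ico (n ^ (j + 1)) ((n + 1) ^ (j + 1)), f k ≤ C * g n := by
    intro n hn
    have hn1 : 1 ≤ n ^ (j + 1) := Nat.one_le_pow _ _ hn
    have hnR : (1 : ℝ) ≤ n := by exact_mod_cast hn
    have hA := hnonneg _ hn1
    have hterm : ∀ k ∈ Finset.Ico (n ^ (j + 1)) ((n + 1) ^ (j + 1)),
        f k ≤ 2 ^ s * (n : ℝ) ^ s * a (n ^ (j + 1)) := by
      intro k hk
      rw [Finset.mem_Ico] at hk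
      have hk1 : (k : ℝ) ≤ (2 * (n : ℝ)) ^ (j + 1) := by
        have : (k : ℝ) ≤ ((n : ℝ) + 1) ^ (j + 1) := by exact_mod_cast hk.2.le
        refine this.trans ?_
        gcongr
        linarith
      have hk2 : (k : ℝ) ^ (s / ((j + 1 : ℕ) : ℝ)) ≤ 2 ^ s * (n : ℝ) ^ s := by
        calc (k : ℝ) ^ (s / ((j + 1 : ℕ) : ℝ))
            ≤ ((2 * (n : ℝ)) ^ (j + 1)) ^ (s / ((j + 1 : ℕ) : ℝ)) :=
              Real.rpow_le_rpow (Nat.cast_nonneg k) hk1 (by positivity)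
          _ = (2 * (n : ℝ)) ^ s := by
              rw [← Real.rpow_natCast, ← Real.rpow_mul (by positivity)]
              congr 1
              have : ((j + 1 : ℕ) : ℝ) ≠ 0 := by positivity
              field_simp
          _ = 2 ^ s * (n : ℝ) ^ s := Real.mul_rpow (by norm_num) (by positivity)
      exact mul_le_mul hk2 (hanti _ _ hn1 hk.1) (hnonneg k (hn1.trans hk.1)) (by positivity)
    have hcard : (((n + 1) ^ (j + 1) - n ^ (j + 1) : ℕ) : ℝ) ≤ 3 ^ (j + 1) * (n : ℝ) ^ j := by
      have h := aux_count n j hn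
      have h' : (n + 1) ^ (j + 1) - n ^ (j + 1) ≤ 3 ^ (j + 1) * n ^ j := by omega
      exact_mod_cast h'
    refine (Finset.sum_le_card_nsmul _ _ _ hterm).trans ?_
    rw [Nat.card_Ico, nsmul_eq_mul]
    refine (mul_le_mul_of_nonneg_right hcard (by positivity)).trans (le_of_eq ?_)
    simp only [hg, hC]
    rw [Real.rpow_add (by linarith), Real.rpow_natCast]
    ring
  have hpart : ∀ N : ℕ, ∑ k ∈ Finset.Ico 1 ((N + 1) ^ (j + 1)), f k
      ≤ C * ∑ n ∈ Finset.range N, g (n + 1) := by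
    intro N
    induction N with
    | zero => simp
    | succ N ih =>
      rw [← Finset.sum_Ico_consecutive f (Nat.one_le_pow (j + 1) (N + 1) (by omega))
        (Nat.pow_le_pow_left (by omega : N + 1 ≤ N + 1 + 1) (j + 1)),
        Finset.sum_range_succ, mul_add]
      exact add_le_add ih (hblock (N + 1) (by omega))
  have hsum' : Summable (fun n => g (n + 1)) := (summable_nat_add_iff 1).2 hsum
  rw [← summable_nat_add_iff 1]
  refine summable_of_sum_range_le (c := C * ∑' n, g (n + 1))
    (fun n => hf0 _ (by omega)) fun N => ?_
  have h1 : ∑ i ∈ Finset.range N, f (i + 1) = ∑ k ∈ Finset.Ico 1 (N + 1), f k := by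
    rw [Finset.sum_Ico_eq_sum_range]
    simp [add_comm]
  rw [h1]
  calc ∑ k ∈ Finset.Ico 1 (N + 1), f k ≤ ∑ k ∈ Finset.Ico 1 ((N + 1) ^ (j + 1)), f k := by
        refine Finset.sum_le_sum_of_subset_of_nonneg
          (Finset.Ico_subset_Ico_right (Nat.le_self_pow (by omega) _)) ?_
        intro k hk _
        exact hf0 k (Finset.mem_Ico.1 hk).1
    _ ≤ C * ∑ n ∈ Finset.range N, g (n + 1) := hpart N
    _ ≤ C * ∑' n, g (n + 1) :=
        mul_le_mul_of_nonneg_left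
          (hsum'.sum_le_tsum _ (fun n _ => hg0 _ (by omega))) hC0
end

section
/- Let $m \ge 2$ and $r \ge 1$ be integers and let $\{a_n\}_{n\ge 1}$ be a decreasing sequence of positive real numbers such that the series $\sum_{n=1}^{\infty} n^{4r+m-1}\, a_{n^m}^2$ converges. Then $a_n = o(n^{-1/2 - 2r/m})$ as $n \to \infty$, i.e. $n^{1/2 + 2r/m} a_n \to 0$. -/
/-- Theorem 2.2 (sequence level): if `m ≥ 2`, `r ≥ 1` and `{a n}` is a decreasing
sequence of positive reals with `∑ n^(4r+m-1) * (a (n^m))^2 < ∞`,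
then `n^(1/2 + 2r/m) * a n → 0`. -/
theorem stmt_11 (m r : ℕ) (hm : 2 ≤ m) (hr : 1 ≤ r)
    (a : ℕ → ℝ)
    (hpos : ∀ n, 1 ≤ n → 0 < a n)
    (hdec : ∀ n, 1 ≤ n → a (n + 1) ≤ a n)
    (hsum : Summable (fun n : ℕ => (n : ℝ) ^ (4 * r + m - 1) * (a (n ^ m)) ^ 2)) :
    Filter.Tendsto
      (fun n : ℕ => (n : ℝ) ^ ((1 : ℝ) / 2 + (2 * r : ℝ) / m) * a n)
      Filter.atTop (nhds 0) := by
  have hanti : ∀ i j, 1 ≤ i → i ≤ j → a j ≤ a i := by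
    intro i j hi hij
    induction j, hij using Nat.le_induction with
    | base => exact le_rfl
    | succ j hj ih => exact (hdec j (hi.trans hj)).trans ih
  obtain ⟨q, hq⟩ : ∃ q, q = 4 * r + m - 1 := ⟨_, rfl⟩
  have hq1 : 4 * r + m = q + 1 := by omega
  rw [← hq] at hsum
  have hmR : (0 : ℝ) < m := by exact_mod_cast (by omega : 0 < m)
  set f : ℕ → ℝ := fun n : ℕ => (n : ℝ) ^ q * (a (n ^ m)) ^ 2 with hf
  set T : ℕ → ℝ := fun k => ∑ j ∈ Finset.Ico (k + 1) (2 * k + 1), f j with hT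
  have hT0 : Filter.Tendsto T Filter.atTop (nhds 0) := by
    have h := hsum.hasSum.tendsto_sum_nat
    have h1 : Filter.Tendsto (fun k : ℕ => 2 * k + 1) Filter.atTop Filter.atTop :=
      Filter.tendsto_atTop_mono (fun k => by simp only [id]; omega) Filter.tendsto_id
    have h2 : Filter.Tendsto (fun k : ℕ => k + 1) Filter.atTop Filter.atTop :=
      Filter.tendsto_atTop_mono (fun k => by simp only [id]; omega) Filter.tendsto_id
    have h3 := (h.comp h1).sub (h.comp h2)
    rw [sub_self] at h3
    refine h3.congr fun k => ?_
    simp only [hT, Function.comp]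
    rw [Finset.sum_Ico_eq_sub _ (by omega)]
  have hTb : ∀ k : ℕ, (k : ℝ) ^ (q + 1) * a ((2 * k) ^ m) ^ 2 ≤ T k := by
    intro k
    have h := Finset.card_nsmul_le_sum (Finset.Ico (k + 1) (2 * k + 1)) f
      ((k : ℝ) ^ q * a ((2 * k) ^ m) ^ 2) (by
        intro j hj
        rw [Finset.mem_Ico] at hj
        have hj1 : 1 ≤ j ^ m := Nat.one_le_pow _ _ (by omega)
        have hjk : j ^ m ≤ (2 * k) ^ m := Nat.pow_le_pow_left (by omega) _
        have h1 := hanti _ _ hj1 hjk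
        have h2 := hpos _ (hj1.trans hjk)
        have h3 : (k : ℝ) ≤ j := by exact_mod_cast (by omega : k ≤ j)
        simp only [hf]
        gcongr)
    rw [Nat.card_Ico, nsmul_eq_mul, show 2 * k + 1 - (k + 1) = k by omega] at h
    calc _ = (k : ℝ) * ((k : ℝ) ^ q * a ((2 * k) ^ m) ^ 2) := by ring
      _ ≤ _ := h
  set K : ℕ → ℕ := fun n => ⌊(n : ℝ) ^ ((1 : ℝ) / m) / 2⌋₊ with hK
  have hKt : Filter.Tendsto K Filter.atTop Filter.atTop := by
    refine tendsto_nat_floor_atTop.comp ?_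
    refine Filter.Tendsto.atTop_div_const (by norm_num) ?_
    exact (tendsto_rpow_atTop (by positivity)).comp tendsto_natCast_atTop_atTop
  have hlim : Filter.Tendsto (fun n => Real.sqrt (4 ^ (q + 1) * T (K n))) Filter.atTop (nhds 0) := by
    have := ((hT0.comp hKt).const_mul ((4 : ℝ) ^ (q + 1))).sqrt
    simpa using this
  refine squeeze_zero' ?_ ?_ hlim
  · filter_upwards [Filter.eventually_ge_atTop 1] with n hn
    have := hpos n hn
    positivity
  · filter_upwards [Filter.eventually_ge_atTop 1, hKt.eventually_ge_atTop 1] with n hn hk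
    apply Real.le_sqrt_of_sq_le
    have han := hpos n hn
    set x : ℝ := (n : ℝ) ^ ((1 : ℝ) / m) with hx
    have hx0 : 0 ≤ x := by positivity
    have hxm : x ^ m = n := by
      rw [hx, one_div]
      exact Real.rpow_inv_natCast_pow (by positivity) (by omega)
    have hxp : ((n : ℝ) ^ ((1 : ℝ) / 2 + (2 * r : ℝ) / m)) ^ 2 = x ^ (q + 1) := by
      rw [hx, ← hq1, ← Real.rpow_mul_natCast (by positivity), ← Real.rpow_mul_natCast (by positivity)]
      congr 1
      push_cast
      field_simp
      ring
    have hkl : (K n : ℝ) ≤ x / 2 := Nat.floor_le (by positivity)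
    have hku : x / 2 < K n + 1 := Nat.lt_floor_add_one _
    have hk1 : (1 : ℝ) ≤ K n := by exact_mod_cast hk
    have hle : (2 * K n) ^ m ≤ n := by
      have : ((2 * K n : ℝ)) ^ m ≤ n := by
        rw [← hxm]
        gcongr
        linarith
      exact_mod_cast this
    have ha := hanti _ _ (Nat.one_le_pow m (2 * K n) (by omega)) hle
    have hx4 : x ≤ 4 * K n := by linarith
    rw [mul_pow, hxp]
    calc x ^ (q + 1) * a n ^ 2 ≤ (4 * K n) ^ (q + 1) * a ((2 * K n) ^ m) ^ 2 := by gcongr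
      _ = 4 ^ (q + 1) * ((K n : ℝ) ^ (q + 1) * a ((2 * K n) ^ m) ^ 2) := by ring
      _ ≤ _ := by
        gcongr
        exact hTb _
end

section
/- Let $m \ge 2$ and $r \ge 1$ be integers, $p > 0$ a real number, and let $\{a_n\}_{n\ge 1}$ be a decreasing sequence of nonnegative real numbers such that the series $\sum_{n=1}^{\infty} n^{2rp+m-1}\, a_{n^m}^p$ converges. Then the series $\sum_{n=1}^{\infty} n^{2rp/m}\, a_n^p$ converges. -/
theorem aux_binom (n : ℝ) (hn : 1 ≤ n) (k : ℕ) :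
    (n + 1) ^ (k + 1) ≤ n ^ (k + 1) + ((2:ℝ) ^ (k + 1) - 1) * n ^ k := by
  induction k with
  | zero => norm_num
  | succ k ih =>
    have h1 : (n + 1) ^ (k + 2) ≤ (n + 1) * (n ^ (k + 1) + ((2:ℝ) ^ (k + 1) - 1) * n ^ k) := by
      rw [pow_succ' (n + 1) (k + 1)]
      exact mul_le_mul_of_nonneg_left ih (by linarith)
    have h2 : (0:ℝ) ≤ (2:ℝ) ^ (k + 1) - 1 := by
      have := one_le_pow₀ (one_le_two : (1:ℝ) ≤ 2) (n := k + 1)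
      linarith
    have h3 : 0 ≤ ((2:ℝ) ^ (k + 1) - 1) * n ^ k * (n - 1) :=
      mul_nonneg (mul_nonneg h2 (by positivity)) (by linarith)
    have e : n ^ (k + 2) + ((2:ℝ) ^ (k + 2) - 1) * n ^ (k + 1) =
      (n + 1) * (n ^ (k + 1) + ((2:ℝ) ^ (k + 1) - 1) * n ^ k)
        + ((2:ℝ) ^ (k + 1) - 1) * n ^ k * (n - 1) := by ring
    show (n + 1) ^ (k + 2) ≤ n ^ (k + 2) + ((2:ℝ) ^ (k + 2) - 1) * n ^ (k + 1)
    linarith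

/-- If `m ≥ 2`, `r ≥ 1`, `p > 0` and `{a n}` is a decreasing sequence of
nonnegative reals with `∑ n^(2rp+m-1) * (a (n^m))^p < ∞`,
then `∑ n^(2rp/m) * (a n)^p` converges. -/
theorem stmt_12 (m r : ℕ) (hm : 2 ≤ m) (hr : 1 ≤ r) (p : ℝ) (hp : 0 < p)
    (a : ℕ → ℝ)
    (hnonneg : ∀ n, 1 ≤ n → 0 ≤ a n)
    (hdec : ∀ n, 1 ≤ n → a (n + 1) ≤ a n)
    (hsum : Summable
      (fun n : ℕ => (n : ℝ) ^ (2 * r * p + m - 1) * (a (n ^ m)) ^ p)) :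
    Summable (fun n : ℕ => (n : ℝ) ^ (2 * r * p / m) * (a n) ^ p) := by
  have hr' : (1:ℝ) ≤ r := by exact_mod_cast hr
  have hm' : (2:ℝ) ≤ m := by exact_mod_cast hm
  have hq : 0 < 2 * (r:ℝ) * p := by positivity
  have hs : 0 < 2 * (r:ℝ) * p / m := by positivity
  have ht : 0 < 2 * (r:ℝ) * p + m - 1 := by linarith
  have hanti : ∀ i j, 1 ≤ i → i ≤ j → a j ≤ a i := by
    intro i j hi hij
    induction j, hij using Nat.le_induction with
    | base => exact le_rfl
    | succ j hj ih => exact (hdec j (hi.trans hj)).trans ih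
  set f : ℕ → ℝ := fun n : ℕ => (n : ℝ) ^ (2 * r * p / m) * (a n) ^ p with hf
  set g : ℕ → ℝ := fun n : ℕ => (n : ℝ) ^ (2 * r * p + m - 1) * (a (n ^ m)) ^ p with hg
  have f0 : f 0 = 0 := by simp [hf, Real.zero_rpow hs.ne']
  have g0 : g 0 = 0 := by simp [hg, Real.zero_rpow ht.ne']
  have fnn : ∀ n, 0 ≤ f n := by
    intro n
    rcases Nat.eq_zero_or_pos n with rfl | h
    · exact f0.ge
    · exact mul_nonneg (by positivity) (Real.rpow_nonneg (hnonneg n h) _)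
  have gnn : ∀ n, 0 ≤ g n := by
    intro n
    rcases Nat.eq_zero_or_pos n with rfl | h
    · exact g0.ge
    · exact mul_nonneg (by positivity) (Real.rpow_nonneg (hnonneg _ (Nat.pow_pos h)) _)
  set C : ℝ := (2:ℝ) ^ m * (2:ℝ) ^ (2 * (r:ℝ) * p) with hC
  have hC0 : 0 ≤ C := by positivity
  have block : ∀ n, 1 ≤ n → ∑ k ∈ Finset.Ico (n ^ m) ((n + 1) ^ m), f k ≤ C * g n := by
    intro n hn
    have hn' : (1:ℝ) ≤ n := by exact_mod_cast hn
    have hA : 0 ≤ a (n ^ m) ^ p := Real.rpow_nonneg (hnonneg _ (Nat.pow_pos hn)) _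
    have hk : ∀ k ∈ Finset.Ico (n ^ m) ((n + 1) ^ m),
        f k ≤ (2:ℝ) ^ (2 * (r:ℝ) * p) * (n:ℝ) ^ (2 * (r:ℝ) * p) * a (n ^ m) ^ p := by
      intro k hk
      rw [Finset.mem_Ico] at hk
      have hpos : 1 ≤ n ^ m := Nat.pow_pos hn
      have hk1 : 1 ≤ k := hpos.trans hk.1
      refine mul_le_mul ?_ ?_ (Real.rpow_nonneg (hnonneg k hk1) _) (by positivity)
      · have h1 : (k:ℝ) ≤ (2 * (n:ℝ)) ^ m := by
          have h2 : (k:ℝ) ≤ ((n:ℝ) + 1) ^ m := by exact_mod_cast hk.2.le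
          exact h2.trans (pow_le_pow_left₀ (by positivity) (by linarith) m)
        calc (k:ℝ) ^ (2 * (r:ℝ) * p / m)
            ≤ ((2 * (n:ℝ)) ^ m) ^ (2 * (r:ℝ) * p / m) :=
              Real.rpow_le_rpow (by positivity) h1 hs.le
          _ = (2 * (n:ℝ)) ^ (2 * (r:ℝ) * p) := by
              rw [← Real.rpow_natCast, ← Real.rpow_mul (by positivity)]
              congr 1
              field_simp
          _ = _ := Real.mul_rpow (by norm_num) (by positivity)
      · exact Real.rpow_le_rpow (hnonneg k hk1) (hanti _ _ hpos hk.1) hp.le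
    have hcard : (((n + 1) ^ m - n ^ m : ℕ) : ℝ) ≤ (2:ℝ) ^ m * (n:ℝ) ^ (m - 1) := by
      rw [Nat.cast_sub (Nat.pow_le_pow_left (Nat.le_succ n) m)]
      push_cast
      obtain ⟨k, rfl⟩ : ∃ k, m = k + 1 := ⟨m - 1, by omega⟩
      have := aux_binom n hn' k
      have h2 : (0:ℝ) ≤ (n:ℝ) ^ k := by positivity
      simp only [Nat.add_sub_cancel]
      linarith
    have hgn : g n = (n:ℝ) ^ (m - 1) * (n:ℝ) ^ (2 * (r:ℝ) * p) * a (n ^ m) ^ p := by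
      have : (n:ℝ) ^ (m - 1) = (n:ℝ) ^ ((m:ℝ) - 1) := by
        rw [← Real.rpow_natCast, Nat.cast_sub (by omega), Nat.cast_one]
      rw [this, ← Real.rpow_add (by linarith)]
      simp only [hg]
      congr 2
      ring
    calc _ ≤ _ := Finset.sum_le_card_nsmul _ _ _ hk
      _ = (((n + 1) ^ m - n ^ m : ℕ) : ℝ) *
          ((2:ℝ) ^ (2 * (r:ℝ) * p) * (n:ℝ) ^ (2 * (r:ℝ) * p) * a (n ^ m) ^ p) := by
          rw [Nat.card_Ico, nsmul_eq_mul]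
      _ ≤ ((2:ℝ) ^ m * (n:ℝ) ^ (m - 1)) *
          ((2:ℝ) ^ (2 * (r:ℝ) * p) * (n:ℝ) ^ (2 * (r:ℝ) * p) * a (n ^ m) ^ p) :=
          mul_le_mul_of_nonneg_right hcard (by positivity)
      _ = C * g n := by rw [hgn, hC]; ring
  have main : ∀ n : ℕ, ∑ k ∈ Finset.range ((n + 1) ^ m), f k
      ≤ C * ∑ k ∈ Finset.range (n + 1), g k := by
    intro n
    induction n with
    | zero => simp [f0, g0]
    | succ n ih =>
      rw [Finset.sum_range_succ, mul_add,
        ← Finset.sum_range_add_sum_Ico _ (Nat.pow_le_pow_left (Nat.le_succ (n + 1)) m)]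
      exact add_le_add ih (block (n + 1) (by omega))
  refine summable_of_sum_range_le (c := C * ∑' k, g k) fnn fun n => ?_
  have hle : n ≤ (n + 1) ^ m := (Nat.le_succ n).trans (Nat.le_self_pow (by omega) _)
  calc _ ≤ ∑ k ∈ Finset.range ((n + 1) ^ m), f k :=
        Finset.sum_le_sum_of_subset_of_nonneg (Finset.range_mono hle) fun i _ _ => fnn i
    _ ≤ _ := main n
    _ ≤ _ := mul_le_mul_of_nonneg_left (hsum.sum_le_tsum _ fun i _ => gnn i) hC0
end

section
/- Let $m \ge 2$ and $r \ge 1$ be integers, $p > 0$ a real number, and let $\{a_n\}_{n\ge 1}$ be a decreasing sequence of positive real numbers such that the series $\sum_{n=1}^{\infty} n^{2rp+m-1}\, a_{n^m}^p$ converges. Then $a_n = o(n^{-1/p - 2r/m})$ as $n \to \infty$, i.e. $n^{1/p + 2r/m} a_n \to 0$. -/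
/-- Theorem 2.3 (sequence level): if `m ≥ 2`, `r ≥ 1`, `p > 0` and `{a n}` is a
decreasing sequence of positive reals with `∑ n^(2rp+m-1) * (a (n^m))^p < ∞`,
then `n^(1/p + 2r/m) * a n → 0`. -/
theorem stmt_13 (m r : ℕ) (hm : 2 ≤ m) (hr : 1 ≤ r) (p : ℝ) (hp : 0 < p)
    (a : ℕ → ℝ)
    (hpos : ∀ n, 1 ≤ n → 0 < a n)
    (hdec : ∀ n, 1 ≤ n → a (n + 1) ≤ a n)
    (hsum : Summable
      (fun n : ℕ => (n : ℝ) ^ (2 * r * p + m - 1) * (a (n ^ m)) ^ p)) :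
    Filter.Tendsto
      (fun n : ℕ => (n : ℝ) ^ (1 / p + (2 * r : ℝ) / m) * a n)
      Filter.atTop (nhds 0) := by
  have hm0 : (0:ℝ) < m := by exact_mod_cast (by omega : 0 < m)
  have hm1 : (1:ℝ) ≤ m := by exact_mod_cast (by omega : 1 ≤ m)
  have hrp : (0:ℝ) ≤ 2 * r * p := by positivity
  have hanti : ∀ i j : ℕ, 1 ≤ i → i ≤ j → a j ≤ a i := by
    intro i j hi hij
    induction j, hij using Nat.le_induction with
    | base => exact le_rfl
    | succ j hj ih => exact (hdec j (by omega)).trans ih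
  set f : ℕ → ℝ := fun n : ℕ => (n : ℝ) ^ (2 * r * p + m - 1) * (a (n ^ m)) ^ p with hf
  have hT := hsum.hasSum.tendsto_sum_nat
  have h2 : Filter.Tendsto (fun k : ℕ => 2 * k) Filter.atTop Filter.atTop :=
    Filter.tendsto_atTop_mono (fun k => by simp only [id]; omega) Filter.tendsto_id
  have hD : Filter.Tendsto (fun k : ℕ => ∑ i ∈ Finset.range (2 * k), f i
      - ∑ i ∈ Finset.range k, f i) Filter.atTop (nhds 0) := by
    simpa using (hT.comp h2).sub hT
  have hlow : ∀ k : ℕ, 1 ≤ k → (k : ℝ) ^ (2 * r * p + m) * (a ((2 * k) ^ m)) ^ p ≤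
      ∑ i ∈ Finset.range (2 * k), f i - ∑ i ∈ Finset.range k, f i := by
    intro k hk
    have hk0 : (0:ℝ) < k := by exact_mod_cast hk
    rw [← Finset.sum_Ico_eq_sub f (by omega : k ≤ 2 * k)]
    have := Finset.card_nsmul_le_sum (Finset.Ico k (2 * k)) f
      ((k : ℝ) ^ (2 * r * p + m - 1) * (a ((2 * k) ^ m)) ^ p) (by
        intro i hi
        rw [Finset.mem_Ico] at hi
        have hi1 : 1 ≤ i ^ m := Nat.one_le_pow _ _ (by omega)
        have h1 : a ((2 * k) ^ m) ≤ a (i ^ m) :=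
          hanti _ _ hi1 (Nat.pow_le_pow_left (by omega) m)
        have h0 : 0 < a ((2 * k) ^ m) := hpos _ (Nat.one_le_pow _ _ (by omega))
        have hki : (k:ℝ) ≤ i := by exact_mod_cast hi.1
        apply mul_le_mul
        · exact Real.rpow_le_rpow hk0.le hki (by linarith)
        · exact Real.rpow_le_rpow h0.le h1 hp.le
        · exact Real.rpow_nonneg h0.le _
        · positivity)
    rw [Nat.card_Ico, (by omega : 2 * k - k = k), nsmul_eq_mul, ← mul_assoc] at this
    have e : (k : ℝ) ^ (2 * r * p + m) = k * (k : ℝ) ^ (2 * r * p + m - 1) := by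
      rw [Real.rpow_sub_one hk0.ne']
      field_simp
    rw [e]
    exact this
  set K : ℕ → ℕ := fun n => ⌊(n : ℝ) ^ (1 / (m : ℝ)) / 2⌋₊ with hK
  have hKt : Filter.Tendsto K Filter.atTop Filter.atTop := by
    apply tendsto_nat_floor_atTop.comp
    apply Filter.Tendsto.atTop_div_const (by norm_num)
    exact (tendsto_rpow_atTop (by positivity)).comp tendsto_natCast_atTop_atTop
  have hE := ((hD.comp hKt).const_mul ((4:ℝ) ^ (2 * r * p + m))).rpow_const
    (p := 1 / p) (Or.inr (by positivity))
  rw [mul_zero, Real.zero_rpow (by positivity)] at hE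
  refine tendsto_of_tendsto_of_tendsto_of_le_of_le' tendsto_const_nhds hE ?_ ?_
  · filter_upwards [Filter.eventually_ge_atTop 1] with n hn
    have := hpos n hn
    positivity
  · filter_upwards [Filter.eventually_ge_atTop 1, hKt.eventually_ge_atTop 1] with n hn hk
    have han := hpos n hn
    have hn0 : (0:ℝ) < n := by exact_mod_cast hn
    set x : ℝ := (n : ℝ) ^ (1 / (m : ℝ)) with hx
    have hx0 : 0 < x := by positivity
    have hxm : x ^ m = n := by
      rw [hx, ← Real.rpow_natCast, ← Real.rpow_mul hn0.le]
      field_simp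
      simp
    have hkle : (K n : ℝ) ≤ x / 2 := Nat.floor_le (by positivity)
    have hklt : x / 2 < K n + 1 := Nat.lt_floor_add_one _
    have hk1 : (1:ℝ) ≤ K n := by exact_mod_cast hk
    have hle : (2 * K n) ^ m ≤ n := by
      have : ((2 * K n : ℝ)) ^ m ≤ n := by
        rw [← hxm]
        exact pow_le_pow_left₀ (by positivity) (by linarith) m
      exact_mod_cast this
    have ha := hanti _ n (Nat.one_le_pow _ _ (by omega)) hle
    have hx4 : x ≤ 4 * K n := by linarith
    have key : (n : ℝ) ^ (1 / p + (2 * r : ℝ) / m) * a n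
        = (x ^ (2 * r * p + m) * a n ^ p) ^ (1 / p) := by
      rw [Real.mul_rpow (by positivity) (by positivity), ← Real.rpow_mul han.le, hx,
        ← Real.rpow_mul hn0.le, ← Real.rpow_mul hn0.le, mul_one_div_cancel hp.ne', Real.rpow_one]
      congr 2
      field_simp
      ring
    rw [key]
    apply Real.rpow_le_rpow (by positivity) _ (by positivity)
    calc x ^ (2 * r * p + m) * a n ^ p
        ≤ (4 * K n : ℝ) ^ (2 * r * p + m) * a ((2 * K n) ^ m) ^ p := by
          apply mul_le_mul
          · exact Real.rpow_le_rpow hx0.le hx4 (by positivity)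
          · exact Real.rpow_le_rpow han.le ha hp.le
          · positivity
          · positivity
      _ = (4:ℝ) ^ (2 * r * p + m) * ((K n : ℝ) ^ (2 * r * p + m) * a ((2 * K n) ^ m) ^ p) := by
          rw [Real.mul_rpow (by norm_num) (by positivity), mul_assoc]
      _ ≤ _ := mul_le_mul_of_nonneg_left (hlow (K n) hk) (by positivity)
end
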